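/- With a supermetric and super-oscillator algebra as in the context, let (A_{cd}) be a complex matrix satisfying the osp symmetry condition A_{cd} = −ε(−1)^{[c][d]+[c]+[d]} A_{dc}, and set A^d_b := Σ_c ε̄^{dc} A_{cb}. Write c^{(a}c^{b)} := (1/2)(c^a c^b − ε(−1)^{[a][b]} c^b c^a). Then for every d ∈ I the adjoint-action identity holds: (ε/2)·Σ_{a,b} (−1)^{[b]} A_{ba} · ( c^{(a}c^{b)}·c^d − (−1)^{([a]+[b])[d]} c^d·c^{(a}c^{b)} ) = Σ_b A^d_b · c^b. -/

import Mathlib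

/-- The sign (−1)^x for a parity x ∈ ZMod 2. -/
noncomputable def sg (x : ZMod 2) : ℂ := if x = 0 then 1 else -1

lemma sg_add (x y : ZMod 2) : sg (x + y) = sg x * sg y := by
  have hadd : x + y = 0 ↔ (x = 0 ↔ y = 0) := by revert x y; decide
  by_cases hx : x = 0 <;> by_cases hy : y = 0 <;> simp [sg, hadd, hx, hy]

lemma sg_mul_self (x : ZMod 2) : sg x * sg x = 1 := by
  unfold sg; split_ifs <;> norm_num

lemma ZMod.two_eq_of_add_eq_zero {x y : ZMod 2} (h : x + y = 0) : x = y := by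
  revert x y; decide

lemma ZMod.two_mul_self (x : ZMod 2) : x * x = x := by
  revert x; decide

/-- The graded bracket of the symmetrised bilinear of two oscillators with a third oscillator. -/
lemma oscillator_bilinear_bracket {I A : Type*} [Ring A] [Algebra ℂ A]
    (p : I → ZMod 2) (ε : ℂ) (hε : ε * ε = 1) (h : I → I → ℂ)
    (hh : ∀ a b, p a + p b ≠ 0 → h a b = 0) (c : I → A)
    (hosc : ∀ a b, c a * c b + (ε * sg (p a * p b)) • (c b * c a) = h a b • (1 : A))
    (a b d : I) :
    (1 / 2 : ℂ) • (c a * c b - (ε * sg (p a * p b)) • (c b * c a)) * c d -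
        sg ((p a + p b) * p d) •
          (c d * ((1 / 2 : ℂ) • (c a * c b - (ε * sg (p a * p b)) • (c b * c a)))) =
      h b d • c a - (ε * sg (p b * p d) * h a d) • c b := by
  have hsym : (1 / 2 : ℂ) • (c a * c b - (ε * sg (p a * p b)) • (c b * c a)) =
      c a * c b - (h a b / 2) • (1 : A) := by
    linear_combination (norm := module) (-1 / 2 : ℂ) • hosc a b
  have hscalar : h a b * sg ((p a + p b) * p d) = h a b := by
    by_cases hab : p a + p b = 0
    · simp [hab, sg]
    · simp [hh a b hab]
  have hleft := congrArg (c a * ·) (hosc b d)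
  have hright := congrArg (· * c b) (hosc a d)
  simp only [mul_add, add_mul, mul_smul_comm, smul_mul_assoc, mul_one, one_mul, mul_assoc]
    at hleft hright
  rw [hsym]
  simp only [mul_sub, sub_mul, mul_smul_comm, smul_mul_assoc, mul_one, one_mul, mul_assoc]
  have hsg : sg ((p a + p b) * p d) = (ε * sg (p b * p d)) * (ε * sg (p a * p d)) := by
    rw [add_mul, sg_add]
    linear_combination -(sg (p a * p d) * sg (p b * p d)) * hε
  have hscalar' : (h a b * sg ((p a + p b) * p d)) • c d = h a b • c d := by rw [hscalar]
  rw [hsg] at hscalar' ⊢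
  linear_combination (norm := module)
    hleft - (ε * sg (p b * p d)) • hright + (1 / 2 : ℂ) • hscalar'

/-- Adjoint action identity: for any supermatrix A obeying the osp symmetry condition,
(1/2)A_{ba}[F^{ab}, c^d] = A^d_b c^b for the super-oscillator bilinears F^{ab}. -/
theorem super_oscillator_adjoint_action
    (n : ℕ) (p : Fin n → ZMod 2) (ε : ℂ) (hε : ε = 1 ∨ ε = -1)
    (εlo εhi : Matrix (Fin n) (Fin n) ℂ)
    (hlo0 : ∀ a b, p a + p b ≠ 0 → εlo a b = 0)
    (hhi0 : ∀ a b, p a + p b ≠ 0 → εhi a b = 0)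
    (hlosym : ∀ a b, εlo a b = ε * sg (p a * p b) * εlo b a)
    (hhisym : ∀ a b, εhi a b = ε * sg (p a * p b) * εhi b a)
    (hinv1 : ∀ a c, (∑ b, εhi a b * εlo b c) = if a = c then 1 else 0)
    (hinv2 : ∀ a c, (∑ b, εlo a b * εhi b c) = if a = c then 1 else 0)
    (A : Type*) [Ring A] [Algebra ℂ A] (c : Fin n → A)
    (hosc : ∀ a b, c a * c b + (ε * sg (p a * p b)) • (c b * c a) = εhi a b • (1 : A))
    (Alo : Matrix (Fin n) (Fin n) ℂ)
    (hAsym : ∀ a b, Alo a b = -(ε * sg (p a * p b + p a + p b)) * Alo b a) :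
    let csym : Fin n → Fin n → A := fun a b =>
      (1 / 2 : ℂ) • (c a * c b - (ε * sg (p a * p b)) • (c b * c a))
    let Aup : Fin n → Fin n → ℂ := fun d b => ∑ cc, εhi d cc * Alo cc b
    ∀ d : Fin n,
      (∑ a, ∑ b, (ε / 2 * sg (p b) * Alo b a) •
          (csym a b * c d - sg ((p a + p b) * p d) • (c d * csym a b))) =
        ∑ b, Aup d b • c b := by
  intro csym Aup d
  have hεε : ε * ε = 1 := by rcases hε with rfl | rfl <;> norm_num
  have hterm (a b : Fin n) :
      (ε / 2 * sg (p b) * Alo b a) •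
          (csym a b * c d - sg ((p a + p b) * p d) • (c d * csym a b)) =
        (1 / 2 * (εhi d b * Alo b a)) • c a + (1 / 2 * (εhi d a * Alo a b)) • c b := by
    rw [oscillator_bilinear_bracket p ε hεε εhi hhi0 c hosc a b d]
    have hfirst : ε * sg (p b) * εhi b d = εhi d b := by
      by_cases hbd : p b + p d = 0
      · rw [hhisym b d, ← ZMod.two_eq_of_add_eq_zero hbd, ZMod.two_mul_self]
        linear_combination
          εhi d b * (sg (p b) * sg (p b) * hεε + sg_mul_self (p b))
      · rw [hhi0 b d hbd, hhi0 d b (by rwa [add_comm]), mul_zero]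
    have hsecond : sg (p b) * sg (p b * p d) * Alo b a * εhi a d = -(εhi d a * Alo a b) := by
      by_cases had : p a + p d = 0
      · rw [hhisym a d, hAsym b a, ← ZMod.two_eq_of_add_eq_zero had, ZMod.two_mul_self,
          sg_add, sg_add]
        have hb := sg_mul_self (p b)
        have ha := sg_mul_self (p a)
        have hba := sg_mul_self (p b * p a)
        calc _ = -((ε * ε) * (sg (p b) * sg (p b)) * (sg (p a) * sg (p a)) *
              (sg (p b * p a) * sg (p b * p a)) * (εhi d a * Alo a b)) := by ring
          _ = _ := by rw [hεε, hb, ha, hba]; ring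
      · rw [hhi0 a d had, hhi0 d a (by rwa [add_comm])]; ring
    rw [smul_sub, smul_smul, smul_smul, sub_eq_add_neg, ← neg_smul]
    congr 2
    · linear_combination (1 / 2 * Alo b a) * hfirst
    · linear_combination (-1 / 2 * ε * ε) * hsecond + (1 / 2 * (εhi d a * Alo a b)) * hεε
  have hAup (b : Fin n) :
      ∑ a, (1 / 2 * (εhi d a * Alo a b)) • c b = (1 / 2 : ℂ) • Aup d b • c b := by
    rw [← Finset.sum_smul, ← Finset.mul_sum, smul_smul]
  simp only [hterm, Finset.sum_add_distrib]
  rw [Finset.sum_comm (f := fun a b => (1 / 2 * (εhi d a * Alo a b)) • c b)]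
  simp only [hAup, ← Finset.smul_sum]
  module
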